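/- arXiv:2107.07394 — 2 statements merged into one kernel-verified Lean document; each statement's English description precedes it below -/
import Mathlib

section
/- Let O be a finite type, γ ∈ [0,1), let (q_t)_{t∈ℕ} be a sequence of pmfs on O, and let p be a pmf on O with p(o) > 0 for all o. Define the discounted observation marginal d(o) = (1-γ) · ∑_{t=0}^{∞} γ^t · q_t(o). Then -(1-γ) · ∑_{t=0}^{∞} γ^t · ∑_{o} q_t(o) · log(p(o)) = -∑_{o} d(o) · log(p(o)) ≥ H(d), and equality holds if and only if p = d. -/
open Real Finset

/-- Shannon entropy of a pmf on a finite type (natural log, with `0 * log 0 = 0`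
automatic since `Real.log 0 = 0`). -/
noncomputable def shannonEntropy {S : Type*} [Fintype S] (μ : S → ℝ) : ℝ :=
  -∑ s, μ s * Real.log (μ s)

/-- The cross-entropy gap of nonnegative weights of equal total mass, as a sum of nonnegative
`klFun` terms. -/
lemma crossEntropy_sub_shannonEntropy {S : Type*} [Fintype S] (μ p : S → ℝ)
    (hp : ∀ s, 0 < p s) (hmass : ∑ s, μ s = ∑ s, p s) :
    -∑ s, μ s * Real.log (p s) - shannonEntropy μ
      = ∑ s, p s * InformationTheory.klFun (μ s / p s) := by
  have hterm (s : S) : p s * InformationTheory.klFun (μ s / p s)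
      = μ s * Real.log (μ s) - μ s * Real.log (p s) + (p s - μ s) := by
    have hps := (hp s).ne'
    rw [InformationTheory.klFun_apply]
    rcases eq_or_ne (μ s) 0 with h | h
    · simp [h]
    · rw [Real.log_div h hps]
      field_simp
      ring
  simp only [hterm, sum_add_distrib, sum_sub_distrib, shannonEntropy, hmass]
  ring

/-- **Gibbs' inequality**: cross-entropy dominates entropy. -/
lemma shannonEntropy_le_crossEntropy {S : Type*} [Fintype S] (μ p : S → ℝ)
    (hμ : ∀ s, 0 ≤ μ s) (hp : ∀ s, 0 < p s) (hmass : ∑ s, μ s = ∑ s, p s) :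
    shannonEntropy μ ≤ -∑ s, μ s * Real.log (p s) := by
  rw [← sub_nonneg, crossEntropy_sub_shannonEntropy μ p hp hmass]
  exact sum_nonneg fun s _ => mul_nonneg (hp s).le
    (InformationTheory.klFun_nonneg (div_nonneg (hμ s) (hp s).le))

/-- The equality case of Gibbs' inequality. -/
lemma crossEntropy_eq_shannonEntropy_iff {S : Type*} [Fintype S] (μ p : S → ℝ)
    (hμ : ∀ s, 0 ≤ μ s) (hp : ∀ s, 0 < p s) (hmass : ∑ s, μ s = ∑ s, p s) :
    -∑ s, μ s * Real.log (p s) = shannonEntropy μ ↔ p = μ := by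
  have hdiv (s : S) : 0 ≤ μ s / p s := div_nonneg (hμ s) (hp s).le
  rw [← sub_eq_zero, crossEntropy_sub_shannonEntropy μ p hp hmass,
    sum_eq_zero_iff_of_nonneg fun s _ => mul_nonneg (hp s).le
      (InformationTheory.klFun_nonneg (hdiv s)), funext_iff]
  refine forall_congr' fun s => ?_
  simp [(hp s).ne', InformationTheory.klFun_eq_zero_iff (hdiv s), div_eq_one_iff_eq, eq_comm]

/-- Discounted sums of observation probabilities converge. -/
lemma summable_discounted_pmf {O : Type*} [Fintype O] {γ : ℝ} (hγ0 : 0 ≤ γ) (hγ1 : γ < 1)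
    {q : ℕ → O → ℝ} (hq0 : ∀ t o, 0 ≤ q t o) (hq1 : ∀ t, ∑ o, q t o = 1) (o : O) :
    Summable fun t => γ ^ t * q t o := by
  refine (summable_geometric_of_lt_one hγ0 hγ1).of_nonneg_of_le
    (fun t => mul_nonneg (pow_nonneg hγ0 t) (hq0 t o)) fun t => ?_
  have hle : q t o ≤ 1 := hq1 t ▸ single_le_sum (fun i _ => hq0 t i) (mem_univ o)
  exact mul_le_of_le_one_right (pow_nonneg hγ0 t) hle

/-- Discounting commutes with expectation over a finite type. -/
lemma discounted_tsum_sum_mul {O : Type*} [Fintype O] {γ : ℝ} {q : ℕ → O → ℝ}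
    (hsum : ∀ o, Summable fun t => γ ^ t * q t o) (f : O → ℝ) :
    (1 - γ) * ∑' t : ℕ, γ ^ t * ∑ o, q t o * f o
      = ∑ o, (1 - γ) * (∑' t : ℕ, γ ^ t * q t o) * f o := by
  simp_rw [mul_sum, ← mul_assoc]
  rw [Summable.tsum_finsetSum fun o _ => (hsum o).mul_right (f o), mul_sum]
  simp_rw [tsum_mul_right, mul_assoc]

/-- The normalized discounted cumulative expected surprise under the
density model `p` equals the cross-entropy of the discounted observation marginal `d`
relative to `p`, which upper-bounds the entropy of `d`, with equality iff `p = d`. -/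
theorem discounted_surprise_ge_entropy {O : Type*} [Fintype O]
    (γ : ℝ) (hγ0 : 0 ≤ γ) (hγ1 : γ < 1)
    (q : ℕ → O → ℝ)
    (hq0 : ∀ t o, 0 ≤ q t o) (hq1 : ∀ t, ∑ o, q t o = 1)
    (p : O → ℝ) (hp0 : ∀ o, 0 < p o) (hp1 : ∑ o, p o = 1)
    (d : O → ℝ) (hd : ∀ o, d o = (1 - γ) * ∑' t : ℕ, γ ^ t * q t o) :
    (-((1 - γ) * ∑' t : ℕ, γ ^ t * ∑ o, q t o * Real.log (p o))
        = -∑ o, d o * Real.log (p o)) ∧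
    (-∑ o, d o * Real.log (p o) ≥ shannonEntropy d) ∧
    ((-∑ o, d o * Real.log (p o) = shannonEntropy d) ↔ p = d) := by
  have hsum := summable_discounted_pmf hγ0 hγ1 hq0 hq1
  have hd0 (o : O) : 0 ≤ d o := by
    rw [hd]
    exact mul_nonneg (sub_nonneg.2 hγ1.le)
      (tsum_nonneg fun t => mul_nonneg (pow_nonneg hγ0 t) (hq0 t o))
  have hd1 : ∑ o, d o = 1 := by
    have h := discounted_tsum_sum_mul hsum fun _ => 1
    simp only [mul_one, hq1, ← hd] at h
    rw [← h, tsum_geometric_of_lt_one hγ0 hγ1, mul_inv_cancel₀ (sub_pos.2 hγ1).ne']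
  have hmass : ∑ o, d o = ∑ o, p o := hd1.trans hp1.symm
  refine ⟨?_, shannonEntropy_le_crossEntropy d p hd0 hp0 hmass,
    crossEntropy_eq_shannonEntropy_iff d p hd0 hp0 hmass⟩
  rw [discounted_tsum_sum_mul hsum]
  simp only [← hd]
end

section
/- Let S be a finite nonempty type and h : S → ℝ. Then the minimum over all pmfs μ on S of ∑_{s} μ(s) · h(s) + H(μ) equals min_{s} h(s), and a pmf μ attains this minimum if and only if μ is a point mass at some state s satisfying h(s) = min_{s'} h(s'). -/
open Real Finset

theorem sum_add_shannonEntropy_sub {S : Type*} [Fintype S] {μ : S → ℝ} (hμ : ∑ s, μ s = 1)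
    (h : S → ℝ) (m : ℝ) :
    (∑ s, μ s * h s) + shannonEntropy μ - m =
      ∑ s, (μ s * (h s - m) + Real.negMulLog (μ s)) := by
  simp only [shannonEntropy, Real.negMulLog, mul_sub, Finset.sum_add_distrib,
    Finset.sum_sub_distrib, ← Finset.sum_mul, hμ, neg_mul, Finset.sum_neg_distrib]
  ring

theorem eq_indicator_of_sum_eq_one {S : Type*} [Fintype S] [DecidableEq S] {μ : S → ℝ}
    (hμ : ∀ s, 0 ≤ μ s) (hsum : ∑ s, μ s = 1) {s₀ : S} (hs₀ : μ s₀ = 1) :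
    μ = fun s => if s = s₀ then (1 : ℝ) else 0 := by
  have hrest : ∑ s ∈ Finset.univ.erase s₀, μ s = 0 := by
    have := Finset.add_sum_erase Finset.univ μ (Finset.mem_univ s₀)
    linarith
  rw [Finset.sum_eq_zero_iff_of_nonneg fun s _ => hμ s] at hrest
  funext s
  split_ifs with hs
  · rw [hs, hs₀]
  · exact hrest s (Finset.mem_erase.2 ⟨hs, Finset.mem_univ s⟩)

/-- **"dark room".** Over pmfs `μ` on a finite nonempty type, the minimum
of `∑ s, μ s * h s + H(μ)` equals `min h`, and it is attained exactly by the point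
masses at states of minimal `h`. -/
theorem dark_room_minimizer {S : Type*} [Fintype S] [Nonempty S] [DecidableEq S]
    (h : S → ℝ) :
    (∀ μ : S → ℝ, (∀ s, 0 ≤ μ s) → ∑ s, μ s = 1 →
      Finset.univ.inf' Finset.univ_nonempty h ≤ (∑ s, μ s * h s) + shannonEntropy μ) ∧
    (∀ μ : S → ℝ, (∀ s, 0 ≤ μ s) → ∑ s, μ s = 1 →
      ((∑ s, μ s * h s) + shannonEntropy μ = Finset.univ.inf' Finset.univ_nonempty h ↔
        ∃ s₀ : S, h s₀ = Finset.univ.inf' Finset.univ_nonempty h ∧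
          μ = fun s => if s = s₀ then (1 : ℝ) else 0)) := by
  set m := Finset.univ.inf' Finset.univ_nonempty h
  have hm (s : S) : 0 ≤ h s - m := sub_nonneg.2 (Finset.inf'_le h (Finset.mem_univ s))
  have hlog {μ : S → ℝ} (hμ : ∀ s, 0 ≤ μ s) (hsum : ∑ s, μ s = 1) (s : S) :
      0 ≤ Real.negMulLog (μ s) :=
    Real.negMulLog_nonneg (hμ s)
      (hsum ▸ Finset.single_le_sum (fun t _ => hμ t) (Finset.mem_univ s))
  have hterm {μ : S → ℝ} (hμ : ∀ s, 0 ≤ μ s) (hsum : ∑ s, μ s = 1) (s : S) :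
      0 ≤ μ s * (h s - m) + Real.negMulLog (μ s) :=
    add_nonneg (mul_nonneg (hμ s) (hm s)) (hlog hμ hsum s)
  refine ⟨fun μ hμ hsum => ?_, fun μ hμ hsum => ⟨fun heq => ?_, ?_⟩⟩
  · rw [← sub_nonneg, sum_add_shannonEntropy_sub hsum]
    exact Finset.sum_nonneg fun s _ => hterm hμ hsum s
  · rw [← sub_eq_zero, sum_add_shannonEntropy_sub hsum,
      Finset.sum_eq_zero_iff_of_nonneg fun s _ => hterm hμ hsum s] at heq
    obtain ⟨s₀, -, hs₀⟩ : ∃ s ∈ Finset.univ, μ s ≠ 0 :=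
      Finset.exists_ne_zero_of_sum_ne_zero (hsum ▸ one_ne_zero)
    obtain ⟨hgap, hent⟩ := (add_eq_zero_iff_of_nonneg (mul_nonneg (hμ s₀) (hm s₀))
      (hlog hμ hsum s₀)).1 (heq s₀ (Finset.mem_univ s₀))
    have hone : μ s₀ = 1 := by
      have hlog_zero : Real.log (μ s₀) = 0 := by
        simpa [Real.negMulLog, hs₀] using hent
      exact Real.eq_one_of_pos_of_log_eq_zero ((hμ s₀).lt_of_ne' hs₀) hlog_zero
    exact ⟨s₀, sub_eq_zero.1 ((mul_eq_zero.1 hgap).resolve_left hs₀),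
      eq_indicator_of_sum_eq_one hμ hsum hone⟩
  · rintro ⟨s₀, hs₀, rfl⟩
    simp [shannonEntropy, hs₀]
end
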